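/- Let h be a nonzero real polynomial all of whose complex zeros lie in the open interval (-1,0) and are simple, and let f be real-rooted with all zeros simple. Then f ◇ h is real-rooted with all zeros simple, and for every real-rooted simple-rooted g with g ≺ f one has g ◇ h ≺ f ◇ h. -/

import Mathlib

open Polynomial

/-- A real polynomial is real-rooted if it is nonzero and all of its complex zeros are real. -/
def RealRooted (f : Polynomial ℝ) : Prop :=
  f ≠ 0 ∧ ∀ z : ℂ, (f.map (algebraMap ℝ ℂ)).IsRoot z → z.im = 0

/-- The zeros of `f`, listed in increasing order (with multiplicity). -/
noncomputable def sortedRoots (f : Polynomial ℝ) : List ℝ :=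
  f.roots.sort (· ≤ ·)

/-- `g ⪯ f`: interlacing. Both are real-rooted, `deg f = deg g + 1`, and listing the zeros of
`f` as `α₁ ≤ ⋯ ≤ α_d` and of `g` as `β₁ ≤ ⋯ ≤ β_{d-1}` (with multiplicity, in increasing
order), one has `α₁ ≤ β₁ ≤ α₂ ≤ ⋯ ≤ β_{d-1} ≤ α_d`. -/
def Interlaces (g f : Polynomial ℝ) : Prop :=
  RealRooted f ∧ RealRooted g ∧ f.natDegree = g.natDegree + 1 ∧
  ∀ i, i < g.natDegree →
    (sortedRoots f).getD i 0 ≤ (sortedRoots g).getD i 0 ∧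
    (sortedRoots g).getD i 0 ≤ (sortedRoots f).getD (i + 1) 0

/-- `g ≺ f`: strict interlacing, where all the inequalities above are strict. -/
def StrictInterlaces (g f : Polynomial ℝ) : Prop :=
  RealRooted f ∧ RealRooted g ∧ f.natDegree = g.natDegree + 1 ∧
  ∀ i, i < g.natDegree →
    (sortedRoots f).getD i 0 < (sortedRoots g).getD i 0 ∧
    (sortedRoots g).getD i 0 < (sortedRoots f).getD (i + 1) 0

/-- Real-rooted with all zeros simple. -/
def SimpleRooted (f : Polynomial ℝ) : Prop :=
  RealRooted f ∧ ∀ θ : ℝ, ¬ ((X - C θ) ^ 2 ∣ f)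

/-- The diamond product `f ◇ g = Σₙ (f⁽ⁿ⁾/n!)(g⁽ⁿ⁾/n!) xⁿ(x+1)ⁿ`. -/
noncomputable def diamond (f g : Polynomial ℝ) : Polynomial ℝ :=
  ∑ n ∈ Finset.range (f.natDegree + 1),
    C (((n.factorial : ℝ) * n.factorial)⁻¹) *
      (derivative^[n] f) * (derivative^[n] g) * (X * (X + 1)) ^ n

/-- The logarithmic derivative has negative imaginary part at points lying above all roots. -/
theorem im_eval_derivative_div_eval_neg {p : ℂ[X]} {z : ℂ} (hle : ∀ r ∈ p.roots, r.im ≤ z.im)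
    (hlt : ∃ r ∈ p.roots, r.im < z.im) (hz : p.eval z ≠ 0) :
    (p.derivative.eval z / p.eval z).im < 0 := by
  rw [(IsAlgClosed.splits p).eval_derivative_div_eval_of_ne_zero hz]
  have him : ∀ r : ℂ, (1 / (z - r)).im = -(z.im - r.im) / Complex.normSq (z - r) := by
    intro r
    simp [Complex.inv_im]
  have hsum : (p.roots.map fun r ↦ 1 / (z - r)).sum.im
      = (p.roots.map fun r ↦ (1 / (z - r)).im).sum := by
    simpa [Function.comp_def] using
      map_multiset_sum Complex.imAddGroupHom (p.roots.map fun r ↦ 1 / (z - r))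
  rw [hsum]
  obtain ⟨r₀, hr₀, hlt₀⟩ := hlt
  have := Multiset.sum_lt_sum (s := p.roots) (f := fun r ↦ (1 / (z - r)).im) (g := fun _ ↦ 0)
    (fun r hr ↦ by
      rw [him]
      exact div_nonpos_of_nonpos_of_nonneg (by linarith [hle r hr]) (Complex.normSq_nonneg _))
    ⟨r₀, hr₀, by
      rw [him]
      refine div_neg_of_neg_of_pos (by linarith) (Complex.normSq_pos.2 fun h ↦ ?_)
      rw [sub_eq_zero] at h
      rw [h] at hlt₀
      exact lt_irrefl _ hlt₀⟩
  simpa using this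

theorem sum_roots_im (p : ℂ[X]) : p.roots.sum.im = (p.roots.map Complex.im).sum :=
  map_multiset_sum Complex.imAddGroupHom p.roots

theorem sum_roots_derivative {p : ℂ[X]} (hp : 2 ≤ p.natDegree) :
    (p.natDegree : ℂ) * p.derivative.roots.sum = (p.natDegree - 1 : ℕ) * p.roots.sum := by
  have hlead : p.leadingCoeff ≠ 0 := leadingCoeff_ne_zero.2 (by rintro rfl; simp at hp)
  have h₁ := (IsAlgClosed.splits p).nextCoeff_eq_neg_sum_roots_mul_leadingCoeff
  have h₂ := (IsAlgClosed.splits p.derivative).nextCoeff_eq_neg_sum_roots_mul_leadingCoeff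
  have hd : p.derivative.natDegree = p.natDegree - 1 := natDegree_derivative p
  obtain ⟨n, hn⟩ : ∃ n, p.natDegree = n + 2 := ⟨p.natDegree - 2, by omega⟩
  rw [leadingCoeff] at h₁ h₂ hlead
  rw [nextCoeff_of_natDegree_pos (by omega), hn] at h₁
  rw [nextCoeff_of_natDegree_pos (by omega), hd, hn] at h₂
  rw [hn] at hlead ⊢
  simp only [coeff_derivative, Nat.add_sub_cancel, show n + 2 - 1 = n + 1 by omega] at h₁ h₂ ⊢
  rw [h₁] at h₂
  apply mul_right_cancel₀ hlead
  push_cast at h₂ ⊢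
  linear_combination h₂

/-- If all roots of `p` lie in the closed lower half-plane, not all of them real, then the vanishing
of a coefficient below the leading one forces all lower coefficients to vanish. -/
theorem coeff_eq_zero_of_roots_im_nonpos (k : ℕ) : ∀ (p : ℂ[X]), (∀ r ∈ p.roots, r.im ≤ 0) →
    (∃ r ∈ p.roots, r.im < 0) → k ≤ p.natDegree → p.coeff k = 0 → ∀ j ≤ k, p.coeff j = 0 := by
  induction k with
  | zero =>
    intro p _ _ _ h0 j hj
    rwa [Nat.le_zero.1 hj]
  | succ k ih =>
    intro p hle hlt hk h0
    have hp0 : p ≠ 0 := by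
      rintro rfl
      simp at hlt
    have hdeg : k + 2 ≤ p.natDegree := by
      rcases hk.eq_or_lt with h | h
      · rw [h] at h0
        exact absurd h0 (leadingCoeff_ne_zero.2 hp0)
      · exact h
    have hle' : ∀ r ∈ p.derivative.roots, r.im ≤ 0 := by
      intro r hr
      by_contra! hpos
      have hpr : p.eval r ≠ 0 := fun h ↦
        absurd (hle r ((mem_roots hp0).2 h)) (not_le.2 hpos)
      have := im_eval_derivative_div_eval_neg (fun s hs ↦ (hle s hs).trans hpos.le)
        (hlt.imp fun s hs ↦ ⟨hs.1, hs.2.trans hpos⟩) hpr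
      rw [(isRoot_of_mem_roots hr).eq_zero] at this
      simp at this
    have hlt' : ∃ r ∈ p.derivative.roots, r.im < 0 := by
      by_contra! hge
      have h₁ : p.roots.sum.im < 0 := by
        rw [sum_roots_im]
        simpa using Multiset.sum_lt_sum (g := fun _ ↦ (0 : ℝ)) hle hlt
      have h₂ : 0 ≤ p.derivative.roots.sum.im := by
        rw [sum_roots_im]
        exact Multiset.sum_nonneg fun y hy ↦ by
          obtain ⟨r, hr, rfl⟩ := Multiset.mem_map.1 hy
          exact hge r hr
      have h₃ := congrArg Complex.im (sum_roots_derivative (p := p) (by omega))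
      rw [← Complex.ofReal_natCast, ← Complex.ofReal_natCast, Complex.im_ofReal_mul,
        Complex.im_ofReal_mul] at h₃
      have h₄ : (0 : ℝ) < (p.natDegree - 1 : ℕ) := by
        exact_mod_cast (by omega : 0 < p.natDegree - 1)
      have := mul_neg_of_pos_of_neg h₄ h₁
      have := mul_nonneg (Nat.cast_nonneg (α := ℝ) p.natDegree) h₂
      linarith
    have hcoeff := ih p.derivative hle' hlt' (by rw [natDegree_derivative]; omega)
      (by rw [coeff_derivative, h0, zero_mul])
    intro j hj
    rcases j with _ | j
    · by_contra h
      have h' : p.eval 0 ≠ 0 := by rwa [← coeff_zero_eq_eval_zero]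
      have := im_eval_derivative_div_eval_neg hle hlt h'
      rw [← coeff_zero_eq_eval_zero, hcoeff 0 (Nat.zero_le _)] at this
      simp at this
    · have := hcoeff j (by omega)
      rw [coeff_derivative] at this
      exact (mul_eq_zero.1 this).resolve_right (by exact_mod_cast j.succ_ne_zero)

theorem im_nonpos_of_eq_sub_mul {x s : ℂ} {θ : ℝ} (hx : 0 ≤ x.im) (h₁ : -1 < θ) (h₀ : θ < 0)
    (h : x * (x + 1) = (θ - x) * s) : s.im ≤ 0 := by
  have hθ : x - θ ≠ 0 := by
    intro h'
    obtain rfl := sub_eq_zero.1 h'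
    rw [sub_self, zero_mul] at h
    norm_cast at h
    exact (mul_neg_of_neg_of_pos h₀ (by linarith : 0 < θ + 1)).ne h
  have hs : s = -(x + 1 + θ) + ((-(θ * (1 + θ)) : ℝ) : ℂ) * (x - θ)⁻¹ := by
    field_simp
    push_cast
    linear_combination h
  rw [hs, Complex.add_im, Complex.im_ofReal_mul, Complex.inv_im]
  have hdiv : -(x - θ).im / Complex.normSq (x - θ) ≤ 0 :=
    div_nonpos_of_nonpos_of_nonneg (by simpa using hx) (Complex.normSq_nonneg _)
  have := mul_nonpos_of_nonneg_of_nonpos (by nlinarith : 0 ≤ -(θ * (1 + θ))) hdiv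
  simp only [Complex.neg_im, Complex.add_im, Complex.one_im, Complex.ofReal_im]
  linarith

/-- Nonvanishing of the complex diamond product at a point of the closed upper half-plane lying
above all roots of `F`. -/
theorem sum_taylor_coeff_mul_ne_zero {F H : ℂ[X]} {x : ℂ} (hx : 0 ≤ x.im)
    (hF0 : 0 < F.natDegree) (hF : ∀ a ∈ F.roots, a.im < x.im) (hH0 : H ≠ 0)
    (hH : ∀ z, H.IsRoot z → z.im = 0 ∧ -1 < z.re ∧ z.re < 0)
    (hH' : H.eval x = 0 → H.derivative.eval x ≠ 0) :
    ∑ n ∈ Finset.range (H.natDegree + 1),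
      (taylor x F).coeff n * ((taylor x H).coeff n * (x * (x + 1)) ^ n) ≠ 0 := by
  set t := x * (x + 1) with ht
  set e := H.natDegree with he
  set A := taylor x F with hA
  set S := (taylor x H).comp (C t * X) with hS
  have hSdeg : S.natDegree ≤ e := by
    refine natDegree_comp_le.trans ?_
    rw [natDegree_taylor]
    exact (Nat.mul_le_mul_left _ ((natDegree_C_mul_le t X).trans natDegree_X_le)).trans
      (by simp [he])
  have hScoeff (n : ℕ) : S.coeff n = (taylor x H).coeff n * t ^ n := comp_C_mul_X_coeff
  set R := S.reflect e with hR
  have hRcoeff : ∀ n ≤ e, R.coeff (e - n) = (taylor x H).coeff n * t ^ n := by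
    intro n hn
    rw [hR, coeff_reflect, revAt_le (Nat.sub_le _ _), Nat.sub_sub_self hn, hScoeff]
  have hsum : ∑ n ∈ Finset.range (e + 1), A.coeff n * ((taylor x H).coeff n * t ^ n)
      = (A * R).coeff e := by
    rw [coeff_mul, Finset.Nat.sum_antidiagonal_eq_sum_range_succ_mk]
    refine Finset.sum_congr rfl fun n hn ↦ ?_
    rw [hRcoeff n (Nat.lt_succ_iff.1 (Finset.mem_range.1 hn))]
  rw [hsum]
  have hRdeg : R.natDegree ≤ e := natDegree_reflect_le.trans (max_le le_rfl hSdeg)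
  have ht0 : H.eval x = 0 → t ≠ 0 := by
    intro hHx h0
    obtain ⟨-, h₁, h₂⟩ := hH x hHx
    rcases mul_eq_zero.1 h0 with h | h
    · rw [h] at h₂
      exact lt_irrefl _ h₂
    · rw [eq_neg_of_add_eq_zero_left h] at h₁
      simp at h₁
  have hF0' : F ≠ 0 := by
    rintro rfl
    simp at hF0
  have hA0 : A ≠ 0 := by simpa [hA] using hF0'
  have hRlow : R ≠ 0 ∧ e ≤ R.natDegree + 1 := by
    by_cases hHx : H.eval x = 0
    · have he1 : 1 ≤ e := by
        rw [he, Nat.one_le_iff_ne_zero]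
        intro h0
        rw [eq_C_of_natDegree_eq_zero h0] at hHx hH0
        simp only [eval_C] at hHx
        simp [hHx] at hH0
      have h1 : R.coeff (e - 1) ≠ 0 := by
        rw [hRcoeff 1 he1, taylor_coeff_one, pow_one]
        exact mul_ne_zero (hH' hHx) (ht0 hHx)
      exact ⟨fun h ↦ h1 (by rw [h, coeff_zero]),
        by have := le_natDegree_of_ne_zero h1; omega⟩
    · have h1 : R.coeff (e - 0) ≠ 0 := by
        rw [hRcoeff 0 (Nat.zero_le _), taylor_coeff_zero, pow_zero, mul_one]
        exact hHx
      exact ⟨fun h ↦ h1 (by rw [h, coeff_zero]),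
        by have := le_natDegree_of_ne_zero h1; omega⟩
  obtain ⟨hR0, hRe⟩ := hRlow
  have hAR0 : A * R ≠ 0 := mul_ne_zero hA0 hR0
  have hAroots : ∀ r, A.IsRoot r → r.im < 0 := by
    intro r hr
    rw [IsRoot, hA, taylor_eval] at hr
    have := hF _ ((mem_roots hF0').2 hr)
    rw [Complex.add_im] at this
    linarith
  have hRroots : ∀ r, R.IsRoot r → r.im ≤ 0 := by
    intro r hr
    by_cases hr0 : r = 0
    · simp [hr0]
    let : Invertible r⁻¹ := invertibleOfNonzero (inv_ne_zero hr0)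
    have hr' := (eval₂_reflect_eq_zero_iff (RingHom.id ℂ) r⁻¹ e S hSdeg).1
      (by rw [invOf_eq_inv, inv_inv]; exact hr)
    have hr'' : H.IsRoot (t * r⁻¹ + x) := by
      rw [eval₂_id, hS, eval_comp, taylor_eval] at hr'
      simpa using hr'
    obtain ⟨him, h₁, h₂⟩ := hH _ hr''
    have hθ : t * r⁻¹ + x = ((t * r⁻¹ + x).re : ℂ) := Complex.ext rfl (by simpa using him)
    refine im_nonpos_of_eq_sub_mul hx h₁ h₂ ?_
    rw [← hθ, ← ht]
    field_simp
    ring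
  have hdegAR : (A * R).natDegree = F.natDegree + R.natDegree := by
    rw [natDegree_mul hA0 hR0, hA, natDegree_taylor]
  intro h0
  have hvanish := coeff_eq_zero_of_roots_im_nonpos e (A * R) (fun r hr ↦ by
      rcases root_mul.1 (isRoot_of_mem_roots hr) with h | h
      · exact (hAroots r h).le
      · exact hRroots r h)
    (by
      obtain ⟨r, hr⟩ := IsAlgClosed.exists_root A
        (degree_ne_of_natDegree_ne (n := 0) (by rw [hA, natDegree_taylor]; omega))
      exact ⟨r, (mem_roots hAR0).2 (root_mul.2 (.inl hr)), hAroots r hr⟩)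
    (by omega) h0
  have hdvd : X ^ (e + 1) ∣ A * R :=
    X_pow_dvd_iff.2 fun j hj ↦ hvanish j (Nat.lt_succ_iff.1 hj)
  have hXA : ¬ X ∣ A := by
    intro h
    rw [X_dvd_iff, coeff_zero_eq_eval_zero] at h
    simpa using hAroots 0 h
  have hle := natDegree_le_of_dvd (prime_X.pow_dvd_of_dvd_mul_left _ hXA hdvd) hR0
  rw [natDegree_X_pow] at hle
  omega

theorem hasseDeriv_map {R S : Type*} [Semiring R] [Semiring S] (φ : R →+* S) (n : ℕ) (p : R[X]) :
    (hasseDeriv n p).map φ = hasseDeriv n (p.map φ) := by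
  ext k
  simp [hasseDeriv_coeff]

theorem iterate_derivative_eq_factorial_mul_hasseDeriv (n : ℕ) (p : ℝ[X]) :
    derivative^[n] p = C (n.factorial : ℝ) * hasseDeriv n p := by
  rw [← factorial_smul_hasseDeriv, LinearMap.smul_apply, nsmul_eq_mul, map_natCast]

theorem diamond_eq_sum_hasseDeriv (f h : ℝ[X]) :
    diamond f h = ∑ n ∈ Finset.range (h.natDegree + 1),
      hasseDeriv n f * hasseDeriv n h * (X * (X + 1)) ^ n := by
  have hterm (n : ℕ) : C (((n.factorial : ℝ) * n.factorial)⁻¹) * derivative^[n] f *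
      derivative^[n] h * (X * (X + 1)) ^ n
      = hasseDeriv n f * hasseDeriv n h * (X * (X + 1)) ^ n := by
    have hn : (n.factorial : ℝ) ≠ 0 := by exact_mod_cast n.factorial_ne_zero
    have hC : C (((n.factorial : ℝ) * n.factorial)⁻¹) * (C (n.factorial : ℝ) * C (n.factorial : ℝ))
        = 1 := by
      rw [← C_mul, ← C_mul, inv_mul_cancel₀ (mul_ne_zero hn hn), C_1]
    rw [iterate_derivative_eq_factorial_mul_hasseDeriv,
      iterate_derivative_eq_factorial_mul_hasseDeriv]
    linear_combination hasseDeriv n f * hasseDeriv n h * (X * (X + 1)) ^ n * hC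
  rw [diamond]
  simp_rw [hterm]
  refine Finset.sum_congr_of_eq_on_inter (fun n _ hn ↦ ?_) (fun n _ hn ↦ ?_) fun _ _ _ ↦ rfl
  · rw [hasseDeriv_eq_zero_of_lt_natDegree h n (by simpa using hn)]
    simp
  · rw [hasseDeriv_eq_zero_of_lt_natDegree f n (by simpa using hn)]
    simp

theorem diamond_C_mul (c : ℝ) (f h : ℝ[X]) : diamond (C c * f) h = C c * diamond f h := by
  simp only [diamond_eq_sum_hasseDeriv, Finset.mul_sum, ← smul_eq_C_mul, map_smul, smul_mul_assoc]

theorem diamond_C (c : ℝ) (h : ℝ[X]) : diamond (C c) h = C c * h := by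
  simp [diamond]

theorem natDegree_X_mul_X_add_one_pow (n : ℕ) : ((X * (X + 1) : ℝ[X]) ^ n).natDegree = 2 * n := by
  have : (X * (X + 1) : ℝ[X]).natDegree = 2 := by compute_degree!
  rw [natDegree_pow, this, mul_comm]

theorem natDegree_diamond_le (f h : ℝ[X]) :
    (diamond f h).natDegree ≤ f.natDegree + h.natDegree := by
  rw [diamond_eq_sum_hasseDeriv]
  refine natDegree_sum_le_of_forall_le _ _ fun n hn ↦ ?_
  have hn' := Nat.lt_succ_iff.1 (Finset.mem_range.1 hn)
  rcases lt_or_ge f.natDegree n with hf | hf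
  · simp [hasseDeriv_eq_zero_of_lt_natDegree f n hf]
  · have h₁ := natDegree_hasseDeriv_le f n
    have h₂ := natDegree_hasseDeriv_le h n
    refine natDegree_mul_le.trans ?_
    rw [natDegree_X_mul_X_add_one_pow]
    have := natDegree_mul_le (p := hasseDeriv n f) (q := hasseDeriv n h)
    omega

theorem coeff_diamond_natDegree_add (f h : ℝ[X]) :
    (diamond f h).coeff (f.natDegree + h.natDegree) = f.leadingCoeff * h.leadingCoeff *
      ∑ n ∈ Finset.range (h.natDegree + 1), (f.natDegree.choose n * h.natDegree.choose n : ℝ) := by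
  rw [diamond_eq_sum_hasseDeriv, finsetSum_coeff, Finset.mul_sum]
  refine Finset.sum_congr rfl fun n hn ↦ ?_
  have hn' := Nat.lt_succ_iff.1 (Finset.mem_range.1 hn)
  rcases lt_or_ge f.natDegree n with hf | hf
  · simp [hasseDeriv_eq_zero_of_lt_natDegree f n hf, Nat.choose_eq_zero_of_lt hf]
  · have h₁ := natDegree_hasseDeriv_le f n
    have h₂ := natDegree_hasseDeriv_le h n
    have hX : ((X * (X + 1) : ℝ[X]) ^ n).coeff (2 * n) = 1 := by
      have hm : ((X * (X + 1) : ℝ[X]) ^ n).Monic :=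
        (monic_X.mul (by simpa using monic_X_add_C (1 : ℝ))).pow n
      have := hm.coeff_natDegree
      rwa [natDegree_X_mul_X_add_one_pow] at this
    rw [show f.natDegree + h.natDegree = (f.natDegree - n) + (h.natDegree - n) + 2 * n by omega,
      coeff_mul_add_eq_of_natDegree_le (natDegree_mul_le.trans (add_le_add h₁ h₂))
        (natDegree_X_mul_X_add_one_pow n).le, coeff_mul_add_eq_of_natDegree_le h₁ h₂, hX,
      hasseDeriv_coeff, hasseDeriv_coeff, Nat.sub_add_cancel hf, Nat.sub_add_cancel hn',
      leadingCoeff, leadingCoeff]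
    ring

theorem natDegree_diamond {f h : ℝ[X]} (hf : f ≠ 0) (hh : h ≠ 0) :
    (diamond f h).natDegree = f.natDegree + h.natDegree := by
  refine natDegree_eq_of_le_of_coeff_ne_zero (natDegree_diamond_le f h) ?_
  rw [coeff_diamond_natDegree_add]
  refine mul_ne_zero (mul_ne_zero (leadingCoeff_ne_zero.2 hf) (leadingCoeff_ne_zero.2 hh))
    (ne_of_gt ?_)
  refine Finset.sum_pos' (fun _ _ ↦ by positivity) ⟨0, by simp, by simp⟩

theorem eval_map_diamond (f h : ℝ[X]) (x : ℂ) :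
    ((diamond f h).map (algebraMap ℝ ℂ)).eval x =
      ∑ n ∈ Finset.range ((h.map (algebraMap ℝ ℂ)).natDegree + 1),
        (taylor x (f.map (algebraMap ℝ ℂ))).coeff n *
          ((taylor x (h.map (algebraMap ℝ ℂ))).coeff n * (x * (x + 1)) ^ n) := by
  rw [diamond_eq_sum_hasseDeriv, Polynomial.map_sum, eval_finsetSum, natDegree_map]
  refine Finset.sum_congr rfl fun n _ ↦ ?_
  simp only [Polynomial.map_mul, hasseDeriv_map, Polynomial.map_pow, map_X, Polynomial.map_add,
    Polynomial.map_one, eval_mul, eval_pow, eval_X, eval_add, eval_one, taylor_coeff]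
  ring

theorem eval_map_ofReal (p : ℝ[X]) (x : ℝ) :
    (p.map (algebraMap ℝ ℂ)).eval (x : ℂ) = (p.eval x : ℝ) :=
  eval_map_apply (algebraMap ℝ ℂ) x

theorem eval_map_conj (p : ℝ[X]) (z : ℂ) :
    (p.map (algebraMap ℝ ℂ)).eval (starRingEnd ℂ z)
      = starRingEnd ℂ ((p.map (algebraMap ℝ ℂ)).eval z) := by
  rw [eval_map_algebraMap, eval_map_algebraMap]
  exact aeval_conj p z

theorem eval_derivative_ne_zero_of_not_sq_dvd {p : ℝ[X]} (hp : ∀ θ : ℝ, ¬ ((X - C θ) ^ 2 ∣ p))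
    {x : ℝ} (hx : p.eval x = 0) : p.derivative.eval x ≠ 0 := by
  intro hx'
  obtain ⟨q, rfl⟩ := dvd_iff_isRoot.2 hx
  rw [derivative_mul] at hx'
  have : q.IsRoot x := by simpa using hx'
  obtain ⟨q, rfl⟩ := dvd_iff_isRoot.2 this
  exact hp x ⟨q, by ring⟩

theorem map_eval_derivative_ne_zero {h : ℝ[X]}
    (hh : ∀ z : ℂ, (h.map (algebraMap ℝ ℂ)).IsRoot z → z.im = 0 ∧ -1 < z.re ∧ z.re < 0)
    (hhsimple : ∀ θ : ℝ, ¬ ((X - C θ) ^ 2 ∣ h)) {x : ℂ}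
    (hx : (h.map (algebraMap ℝ ℂ)).eval x = 0) :
    (h.map (algebraMap ℝ ℂ)).derivative.eval x ≠ 0 := by
  have hre : x = (x.re : ℂ) := Complex.ext rfl (by simpa using (hh x hx).1)
  rw [hre, eval_map_ofReal] at hx
  rw [hre, derivative_map, eval_map_ofReal]
  exact_mod_cast eval_derivative_ne_zero_of_not_sq_dvd hhsimple (by exact_mod_cast hx)

theorem realRooted_diamond {f h : ℝ[X]} (hf : RealRooted f) (hf0 : 0 < f.natDegree) (hh0 : h ≠ 0)
    (hh : ∀ z : ℂ, (h.map (algebraMap ℝ ℂ)).IsRoot z → z.im = 0 ∧ -1 < z.re ∧ z.re < 0)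
    (hhsimple : ∀ θ : ℝ, ¬ ((X - C θ) ^ 2 ∣ h)) : RealRooted (diamond f h) := by
  have hpos : ∀ z : ℂ, 0 < z.im → ((diamond f h).map (algebraMap ℝ ℂ)).eval z ≠ 0 := by
    intro z hz
    rw [eval_map_diamond]
    refine sum_taylor_coeff_mul_ne_zero hz.le (by simpa using hf0) (fun a ha ↦ ?_)
      (by simpa [Polynomial.map_eq_zero] using hh0) hh (map_eval_derivative_ne_zero hh hhsimple)
    rw [hf.2 a (isRoot_of_mem_roots ha)]
    exact hz
  refine ⟨fun h0 ↦ ?_, fun z hz ↦ ?_⟩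
  · have := hpos Complex.I (by simp)
    simp [h0] at this
  · rcases lt_trichotomy z.im 0 with h | h | h
    · refine absurd ?_ (hpos (starRingEnd ℂ z) (by simpa using h))
      rw [eval_map_conj, hz.eq_zero, map_zero]
    · exact h
    · exact absurd hz (hpos z h)

theorem natDegree_map_add_I_mul_map {f g : ℝ[X]} (hfg : g.natDegree < f.natDegree) :
    (f.map (algebraMap ℝ ℂ) + C Complex.I * g.map (algebraMap ℝ ℂ)).natDegree = f.natDegree := by
  rw [natDegree_add_eq_left_of_natDegree_lt, natDegree_map]
  rw [natDegree_C_mul Complex.I_ne_zero, natDegree_map, natDegree_map]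
  exact hfg

/-- If all roots of `P + iQ` lie in the open lower half-plane, then the Wronskian of `Q`
and `P` is positive on `ℝ`. -/
theorem wronskian_pos_of_roots_im_neg {P Q : ℝ[X]} (hPQ : Q.natDegree < P.natDegree)
    (hroots : ∀ z : ℂ, (P.map (algebraMap ℝ ℂ) + C Complex.I * Q.map (algebraMap ℝ ℂ)).IsRoot z →
      z.im < 0) (x : ℝ) :
    0 < P.derivative.eval x * Q.eval x - P.eval x * Q.derivative.eval x := by
  set F := P.map (algebraMap ℝ ℂ) + C Complex.I * Q.map (algebraMap ℝ ℂ) with hF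
  have hdeg : F.natDegree = P.natDegree := natDegree_map_add_I_mul_map hPQ
  have hF0 : F ≠ 0 := by
    intro h
    rw [h, natDegree_zero] at hdeg
    omega
  have hFx : F.eval (x : ℂ) ≠ 0 := fun h ↦ by simpa using hroots x h
  obtain ⟨r, hr⟩ := IsAlgClosed.exists_root F (degree_ne_of_natDegree_ne (n := 0) (by omega))
  have hlog := im_eval_derivative_div_eval_neg (p := F) (z := x)
    (fun r hr ↦ by simpa using (hroots r (isRoot_of_mem_roots hr)).le)
    ⟨r, (mem_roots hF0).2 hr, by simpa using hroots r hr⟩ hFx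
  have hE : F.eval (x : ℂ) = ⟨P.eval x, Q.eval x⟩ := by
    rw [hF, eval_add, eval_mul, eval_C, eval_map_ofReal, eval_map_ofReal]
    apply Complex.ext <;> simp
  have hE' : F.derivative.eval (x : ℂ) = ⟨P.derivative.eval x, Q.derivative.eval x⟩ := by
    rw [hF, derivative_add, derivative_C_mul, derivative_map, derivative_map, eval_add, eval_mul,
      eval_C, eval_map_ofReal, eval_map_ofReal]
    apply Complex.ext <;> simp
  have hpos := Complex.normSq_pos.2 hFx
  rw [Complex.div_im, ← sub_div, div_neg_iff] at hlog
  rcases hlog with h | h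
  · exact absurd h.2 (not_lt.2 hpos.le)
  · have := h.1
    rw [hE, hE'] at this
    simp only at this
    linarith

theorem wronskian_diamond_pos {f g h : ℝ[X]} (hfg : g.natDegree < f.natDegree)
    (hroots : ∀ z : ℂ, (f.map (algebraMap ℝ ℂ) + C Complex.I * g.map (algebraMap ℝ ℂ)).IsRoot z →
      z.im < 0) (hh0 : h ≠ 0)
    (hh : ∀ z : ℂ, (h.map (algebraMap ℝ ℂ)).IsRoot z → z.im = 0 ∧ -1 < z.re ∧ z.re < 0)
    (hhsimple : ∀ θ : ℝ, ¬ ((X - C θ) ^ 2 ∣ h)) (x : ℝ) :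
    0 < (diamond f h).derivative.eval x * (diamond g h).eval x
      - (diamond f h).eval x * (diamond g h).derivative.eval x := by
  have hf0 : f ≠ 0 := by
    rintro rfl
    simp at hfg
  refine wronskian_pos_of_roots_im_neg ?_ (fun z hz ↦ ?_) x
  · rw [natDegree_diamond hf0 hh0]
    have := natDegree_diamond_le g h
    omega
  · by_contra! hz0
    refine sum_taylor_coeff_mul_ne_zero hz0
      (by rw [natDegree_map_add_I_mul_map hfg]; omega)
      (fun a ha ↦ (hroots a (isRoot_of_mem_roots ha)).trans_le hz0)
      (by simpa [Polynomial.map_eq_zero] using hh0) hh (map_eval_derivative_ne_zero hh hhsimple) ?_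
    rw [IsRoot, eval_add, eval_mul, eval_C, eval_map_diamond, eval_map_diamond] at hz
    rw [← hz, Finset.mul_sum, ← Finset.sum_add_distrib]
    refine Finset.sum_congr rfl fun n _ ↦ ?_
    rw [map_add, coeff_add, taylor_mul, taylor_C, coeff_C_mul]
    ring

theorem RealRooted.splits {f : ℝ[X]} (hf : RealRooted f) : f.Splits := by
  refine Splits.of_splits_map_of_injective (algebraMap ℝ ℂ).injective (IsAlgClosed.splits _)
    fun z hz ↦ ⟨z.re, ?_⟩
  exact Complex.ext rfl (by simpa using (hf.2 z (isRoot_of_mem_roots hz)).symm)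

theorem realRooted_of_splits {f : ℝ[X]} (hf0 : f ≠ 0) (hf : f.Splits) : RealRooted f := by
  refine ⟨hf0, fun z hz ↦ ?_⟩
  obtain ⟨r, rfl⟩ := hf.mem_range_of_isRoot hf0 hz
  simp

theorem SimpleRooted.nodup_roots {f : ℝ[X]} (hf : SimpleRooted f) : f.roots.Nodup := by
  rw [Multiset.nodup_iff_count_le_one]
  intro a
  rw [count_roots]
  by_contra! h
  exact hf.2 a ((pow_dvd_pow _ h).trans (pow_rootMultiplicity_dvd f a))

theorem sortedRoots_eq_ofFn {f : ℝ[X]} {n : ℕ} {α : Fin n → ℝ} (hα : StrictMono α)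
    (hroots : f.roots = Multiset.ofList (List.ofFn α)) : sortedRoots f = List.ofFn α := by
  refine List.Perm.eq_of_sortedLE (Multiset.pairwise_sort _ _).sortedLE
    hα.sortedLT_ofFn.sortedLE ?_
  rw [← Multiset.coe_eq_coe, sortedRoots, Multiset.sort_eq, hroots]

theorem SimpleRooted.exists_strictMono {f : ℝ[X]} (hf : SimpleRooted f) {n : ℕ}
    (hn : f.natDegree = n) : ∃ α : Fin n → ℝ, StrictMono α ∧ sortedRoots f = List.ofFn α ∧
      f = C f.leadingCoeff * ∏ i, (X - C (α i)) := by
  have hlen : (sortedRoots f).length = n := by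
    rw [sortedRoots, Multiset.length_sort, splits_iff_card_roots.1 hf.1.splits, hn]
  have hcoe : (sortedRoots f : Multiset ℝ) = f.roots := Multiset.sort_eq _ _
  have hnodup : (sortedRoots f).Nodup := by
    rw [← Multiset.coe_nodup, hcoe]
    exact hf.nodup_roots
  have hsorted : (sortedRoots f).SortedLT :=
    (Multiset.pairwise_sort f.roots (· ≤ ·)).sortedLE.sortedLT_of_nodup hnodup
  clear hn
  subst hlen
  refine ⟨(sortedRoots f).get, hsorted, (List.ofFn_get _).symm, ?_⟩
  conv_lhs => rw [hf.1.splits.eq_prod_roots, ← hcoe, Multiset.map_coe, Multiset.prod_coe]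
  rw [← List.prod_ofFn]
  conv_lhs => rw [← List.ofFn_get (sortedRoots f), List.map_ofFn]
  rfl

theorem eval_derivative_C_mul_prod {n : ℕ} (c : ℝ) (α : Fin (n + 1) → ℝ) (i : Fin (n + 1)) :
    (derivative (C c * ∏ j, (X - C (α j)))).eval (α i) = c * ∏ j, (α i - α (i.succAbove j)) := by
  rw [Fin.prod_univ_succAbove _ i]
  simp [derivative_mul, eval_prod]

/-- Up to a scalar, a strict interlacer of `f` has the sign of the
derivative of `f` at every root of `f`. -/
theorem StrictInterlaces.exists_scale {f g : ℝ[X]} (hf : SimpleRooted f) (hg : SimpleRooted g)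
    (hgf : StrictInterlaces g f) : ∃ s : ℝ, s ≠ 0 ∧
      ∀ x, f.eval x = 0 → 0 < f.derivative.eval x * (C s * g).eval x := by
  obtain ⟨-, -, hdeg, hlt⟩ := hgf
  obtain ⟨β, -, hβs, hβ⟩ := hg.exists_strictMono rfl
  obtain ⟨α, hα, hαs, hfα⟩ := hf.exists_strictMono hdeg
  have hc : f.leadingCoeff ≠ 0 := leadingCoeff_ne_zero.2 hf.1.1
  have hc' : g.leadingCoeff ≠ 0 := leadingCoeff_ne_zero.2 hg.1.1
  refine ⟨f.leadingCoeff * g.leadingCoeff, mul_ne_zero hc hc', fun x hx ↦ ?_⟩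
  obtain ⟨i, rfl⟩ : ∃ i, x = α i := by
    rw [hfα] at hx
    simpa [hc, eval_prod, Finset.prod_eq_zero_iff, sub_eq_zero] using hx
  have hlow (j : Fin g.natDegree) : α j.castSucc < β j := by
    have := (hlt j j.2).1
    rw [hαs, hβs, List.getD_eq_getElem _ _ (by simp),
      List.getD_eq_getElem _ _ (by simp)] at this
    simp only [List.getElem_ofFn] at this
    exact this
  have hhigh (j : Fin g.natDegree) : β j < α j.succ := by
    have := (hlt j j.2).2
    rw [hαs, hβs, List.getD_eq_getElem _ _ (by simp), List.getD_eq_getElem _ _ (by simp)] at this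
    simp only [List.getElem_ofFn] at this
    exact this
  have hf' : f.derivative.eval (α i) = f.leadingCoeff * ∏ j, (α i - α (i.succAbove j)) := by
    conv_lhs => rw [hfα]
    exact eval_derivative_C_mul_prod _ α i
  have hg' : g.eval (α i) = g.leadingCoeff * ∏ j, (α i - β j) := by
    conv_lhs => rw [hβ]
    simp [eval_prod]
  have hpos : 0 < ∏ j, ((α i - α (i.succAbove j)) * (α i - β j)) := by
    refine Finset.prod_pos fun j _ ↦ ?_
    rcases lt_or_ge j.castSucc i with h | h
    · rw [Fin.succAbove_of_castSucc_lt _ _ h]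
      have := hα.monotone (Fin.castSucc_lt_iff_succ_le.1 h)
      exact mul_pos (sub_pos.2 (hα h)) (by linarith [hhigh j])
    · rw [Fin.succAbove_of_le_castSucc _ _ h]
      have := hα.monotone h
      exact mul_pos_of_neg_of_neg (by linarith [hhigh j, hlow j]) (by linarith [hlow j])
  rw [Finset.prod_mul_distrib] at hpos
  rw [hf', eval_mul, eval_C, hg']
  have : 0 < (f.leadingCoeff * g.leadingCoeff) ^ 2 := by positivity
  calc 0 < _ := mul_pos this hpos
    _ = _ := by ring

/-- If `g` and the derivative of `f` have the same sign at every root of `f`, then all roots of `f + ig` lie in the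
open lower half-plane, by Lagrange interpolation of `g` at the roots of `f`. -/
theorem roots_im_neg_of_derivative_mul_pos {f g : ℝ[X]} (hf : SimpleRooted f)
    (hfg : g.natDegree < f.natDegree)
    (hpos : ∀ x, f.eval x = 0 → 0 < f.derivative.eval x * g.eval x) (z : ℂ)
    (hz : (f.map (algebraMap ℝ ℂ) + C Complex.I * g.map (algebraMap ℝ ℂ)).IsRoot z) :
    z.im < 0 := by
  obtain ⟨α, hα, -, hfα⟩ := hf.exists_strictMono rfl
  have hc : f.leadingCoeff ≠ 0 := leadingCoeff_ne_zero.2 hf.1.1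
  have hαroot (i) : f.eval (α i) = 0 := by
    rw [hfα]
    simp only [eval_mul, eval_C, eval_prod, eval_sub, eval_X]
    rw [Finset.prod_eq_zero (Finset.mem_univ i) (sub_self _), mul_zero]
  by_contra! hz0
  rw [IsRoot, eval_add, eval_mul, eval_C] at hz
  set v : Fin f.natDegree → ℂ := fun i ↦ (α i : ℂ) with hv
  have hvinj : Set.InjOn v (Finset.univ : Finset (Fin f.natDegree)) :=
    fun i _ j _ hij ↦ hα.injective (Complex.ofReal_injective hij)
  have hnot : ∀ i ∈ Finset.univ, z ≠ v i := by
    rintro i - rfl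
    rw [hv, eval_map_ofReal, eval_map_ofReal, hαroot] at hz
    have := hpos _ (hαroot i)
    have hg0 : g.eval (α i) = 0 := by simpa using hz
    rw [hg0, mul_zero] at this
    exact lt_irrefl _ this
  have hfmap : f.map (algebraMap ℝ ℂ) =
      C (f.leadingCoeff : ℂ) * Lagrange.nodal Finset.univ v := by
    conv_lhs => rw [hfα]
    simp [Lagrange.nodal, Polynomial.map_prod, hv]
  have hgdeg : (g.map (algebraMap ℝ ℂ)).degree < (Finset.univ : Finset (Fin f.natDegree)).card := by
    rw [Finset.card_univ, Fintype.card_fin]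
    exact degree_le_natDegree.trans_lt (by rw [natDegree_map]; exact_mod_cast hfg)
  have hgz : (g.map (algebraMap ℝ ℂ)).eval z = (Lagrange.nodal Finset.univ v).eval z *
      ∑ i, Lagrange.nodalWeight Finset.univ v i * (z - v i)⁻¹ *
        (g.map (algebraMap ℝ ℂ)).eval (v i) := by
    conv_lhs => rw [Lagrange.eq_interpolate hvinj hgdeg]
    exact Lagrange.eval_interpolate_not_at_node _ hnot
  have hweight (i) : Lagrange.nodalWeight Finset.univ v i * (z - v i)⁻¹ *
      (g.map (algebraMap ℝ ℂ)).eval (v i) =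
      f.leadingCoeff * (((g.eval (α i) / f.derivative.eval (α i) : ℝ) : ℂ) * (z - v i)⁻¹) := by
    have hder : ((f.derivative.eval (α i) : ℝ) : ℂ) =
        f.leadingCoeff * (derivative (Lagrange.nodal Finset.univ v)).eval (v i) := by
      rw [← eval_map_ofReal, ← derivative_map, hfmap, derivative_C_mul, eval_mul, eval_C]
    have hcC : (f.leadingCoeff : ℂ) ≠ 0 := by exact_mod_cast hc
    rw [Lagrange.nodalWeight_eq_eval_derivative_nodal (Finset.mem_univ i), hv, eval_map_ofReal,
      Complex.ofReal_div, hder, hv, div_eq_mul_inv, mul_inv]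
    linear_combination -(eval (↑(α i)) (derivative (Lagrange.nodal Finset.univ v)))⁻¹ *
      (z - α i)⁻¹ * ((g.eval (α i) : ℝ) : ℂ) * mul_inv_cancel₀ hcC
  have hnode : (Lagrange.nodal Finset.univ v).eval z ≠ 0 := Lagrange.eval_nodal_not_at_node hnot
  simp_rw [hweight] at hgz
  rw [← Finset.mul_sum] at hgz
  set σ := ∑ i, ((g.eval (α i) / f.derivative.eval (α i) : ℝ) : ℂ) * (z - v i)⁻¹ with hσ
  have hzero : 1 + Complex.I * σ = 0 := by
    rw [hfmap, hgz, eval_mul, eval_C] at hz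
    have hcC : (f.leadingCoeff : ℂ) ≠ 0 := by exact_mod_cast hc
    refine (mul_eq_zero.1 (?_ : (f.leadingCoeff * (Lagrange.nodal Finset.univ v).eval z) *
      (1 + Complex.I * σ) = 0)).resolve_left (mul_ne_zero hcC hnode)
    rw [← hz]
    ring
  have him : σ.im ≤ 0 := by
    rw [hσ, Complex.im_sum]
    refine Finset.sum_nonpos fun i _ ↦ ?_
    rw [Complex.im_ofReal_mul, Complex.inv_im]
    refine mul_nonpos_of_nonneg_of_nonpos ?_
      (div_nonpos_of_nonpos_of_nonneg (by simpa [hv] using hz0) (Complex.normSq_nonneg _))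
    rcases mul_pos_iff.1 (hpos _ (hαroot i)) with h | h
    · exact (div_pos h.2 h.1).le
    · exact (div_pos_of_neg_of_neg h.2 h.1).le
  have := congrArg Complex.re hzero
  simp at this
  linarith

/-- If the Wronskian of `P` and `Q` has no zero, then `Q` vanishes between any two zeros of `P`. -/
theorem exists_root_between {P Q : ℝ[X]} (hW : ∀ x, P.derivative.eval x * Q.eval x
    - P.eval x * Q.derivative.eval x ≠ 0) {a b : ℝ} (hab : a < b) (ha : P.eval a = 0)
    (hb : P.eval b = 0) : ∃ c, a < c ∧ c < b ∧ Q.eval c = 0 := by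
  by_contra! hQ
  have hQ' : ∀ x ∈ Set.Icc a b, Q.eval x ≠ 0 := by
    intro x hx hx0
    rcases hx.1.eq_or_lt with h | h
    · refine hW x ?_
      rw [hx0, ← h, ha]
      ring
    · rcases hx.2.eq_or_lt with h' | h'
      · refine hW x ?_
        rw [hx0, h', hb]
        ring
      · exact hQ x h h' hx0
  obtain ⟨c, hc, hc0⟩ := exists_hasDerivAt_eq_zero (f := fun x ↦ P.eval x / Q.eval x)
    (f' := fun x ↦ (P.derivative.eval x * Q.eval x - P.eval x * Q.derivative.eval x)
      / Q.eval x ^ 2) hab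
    (P.continuous.continuousOn.div Q.continuous.continuousOn hQ') (by simp [ha, hb])
    fun x hx ↦ (P.hasDerivAt x).div (Q.hasDerivAt x) (hQ' x (Set.Ioo_subset_Icc_self hx))
  rw [div_eq_zero_iff] at hc0
  rcases hc0 with h | h
  · exact hW c h
  · exact hQ' c (Set.Ioo_subset_Icc_self hc) (pow_eq_zero_iff two_ne_zero |>.1 h)

theorem strictInterlaces_of_wronskian_ne_zero {P Q : ℝ[X]} (hP : SimpleRooted P) (hQ0 : Q ≠ 0)
    (hdeg : P.natDegree = Q.natDegree + 1) (hW : ∀ x, P.derivative.eval x * Q.eval x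
      - P.eval x * Q.derivative.eval x ≠ 0) : StrictInterlaces Q P := by
  obtain ⟨α, hα, hαs, hPα⟩ := hP.exists_strictMono hdeg
  have hαroot (i) : P.eval (α i) = 0 := by
    rw [hPα]
    simp only [eval_mul, eval_C, eval_prod, eval_sub, eval_X]
    rw [Finset.prod_eq_zero (Finset.mem_univ i) (sub_self _), mul_zero]
  choose β hlow hhigh hβ using fun j : Fin Q.natDegree ↦
    exists_root_between hW (hα j.castSucc_lt_succ) (hαroot _) (hαroot _)
  have hβmono : StrictMono β := by
    intro i j hij
    have := hα.monotone (Fin.succ_le_castSucc_iff.2 hij)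
    linarith [hhigh i, hlow j]
  have hroots : Q.roots = Multiset.ofList (List.ofFn β) := by
    refine (Multiset.eq_of_le_of_card_le ?_ ?_).symm
    · refine (Multiset.le_iff_subset ?_).2 ?_
      · rw [Multiset.coe_nodup]
        exact hβmono.sortedLT_ofFn.nodup
      · intro x hx
        obtain ⟨j, rfl⟩ := (List.mem_ofFn' β x).1 (Multiset.mem_coe.1 hx)
        exact (mem_roots hQ0).2 (hβ j)
    · simpa using card_roots' Q
  have hQ : RealRooted Q :=
    realRooted_of_splits hQ0 (splits_iff_card_roots.2 (by simp [hroots]))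
  refine ⟨hP.1, hQ, hdeg, fun i hi ↦ ?_⟩
  rw [hαs, sortedRoots_eq_ofFn hβmono hroots]
  have h₁ := hlow ⟨i, hi⟩
  have h₂ := hhigh ⟨i, hi⟩
  rw [List.getD_eq_getElem _ _ (by simpa using hi.trans (Nat.lt_succ_self _)),
    List.getD_eq_getElem _ _ (by simpa using hi), List.getD_eq_getElem _ _ (by simpa using hi)]
  simp only [List.getElem_ofFn]
  exact ⟨h₁, h₂⟩

theorem not_sq_dvd_of_wronskian_ne_zero {P Q : ℝ[X]} (hW : ∀ x, P.derivative.eval x * Q.eval x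
    - P.eval x * Q.derivative.eval x ≠ 0) (θ : ℝ) : ¬ ((X - C θ) ^ 2 ∣ P) := by
  rintro ⟨q, rfl⟩
  refine hW θ ?_
  simp [derivative_mul, derivative_pow]

theorem SimpleRooted.derivative_mul_derivative_pos {f : ℝ[X]} (hf : SimpleRooted f) {x : ℝ}
    (hx : f.eval x = 0) : 0 < f.derivative.eval x * f.derivative.eval x :=
  mul_self_pos.2 (eval_derivative_ne_zero_of_not_sq_dvd hf.2 hx)

theorem simpleRooted_diamond {f h : ℝ[X]} (hf : SimpleRooted f) (hh0 : h ≠ 0)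
    (hh : ∀ z : ℂ, (h.map (algebraMap ℝ ℂ)).IsRoot z → z.im = 0 ∧ -1 < z.re ∧ z.re < 0)
    (hhsimple : ∀ θ : ℝ, ¬ ((X - C θ) ^ 2 ∣ h)) : SimpleRooted (diamond f h) := by
  rcases Nat.eq_zero_or_pos f.natDegree with hdeg | hdeg
  · rw [eq_C_of_natDegree_eq_zero hdeg, diamond_C]
    have hc : f.coeff 0 ≠ 0 := by
      intro h0
      apply hf.1.1
      rw [eq_C_of_natDegree_eq_zero hdeg, h0, C_0]
    refine ⟨⟨mul_ne_zero (C_ne_zero.2 hc) hh0, fun z hz ↦ (hh z ?_).1⟩, fun θ hθ ↦ hhsimple θ ?_⟩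
    · simpa [IsRoot, hc] using hz
    · exact ((isUnit_C.2 hc.isUnit).dvd_mul_left).1 hθ
  · refine ⟨realRooted_diamond hf.1 hdeg hh0 hh hhsimple, not_sq_dvd_of_wronskian_ne_zero
      (Q := diamond f.derivative h) fun x ↦ (wronskian_diamond_pos ?_ ?_ hh0 hh hhsimple x).ne'⟩
    · exact natDegree_derivative_lt hdeg.ne'
    · exact roots_im_neg_of_derivative_mul_pos hf (natDegree_derivative_lt hdeg.ne')
        fun x hx ↦ hf.derivative_mul_derivative_pos hx

/-- **Theorem 2.12 (b).** If `h` is nonzero with all complex zeros simple and in the open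
interval `(-1,0)`, and `f` is real-rooted with all zeros simple, then `f ◇ h` is real-rooted
with all zeros simple, and `g ≺ f` implies `g ◇ h ≺ f ◇ h` for simple-rooted `g`. -/
theorem diamond_simple_rooted_and_strict_interlaces (h f : Polynomial ℝ)
    (hh0 : h ≠ 0)
    (hh : ∀ z : ℂ, (h.map (algebraMap ℝ ℂ)).IsRoot z → z.im = 0 ∧ -1 < z.re ∧ z.re < 0)
    (hhsimple : ∀ θ : ℝ, ¬ ((X - C θ) ^ 2 ∣ h))
    (hf : SimpleRooted f) :
    SimpleRooted (diamond f h) ∧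
    (∀ g : Polynomial ℝ, SimpleRooted g → StrictInterlaces g f →
      StrictInterlaces (diamond g h) (diamond f h)) := by
  refine ⟨simpleRooted_diamond hf hh0 hh hhsimple, fun g hg hgf ↦ ?_⟩
  obtain ⟨s, hs, hpos⟩ := hgf.exists_scale hf hg
  have hdeg := hgf.2.2.1
  have hdeg' : (C s * g).natDegree < f.natDegree := by
    rw [natDegree_C_mul hs]
    omega
  refine strictInterlaces_of_wronskian_ne_zero (simpleRooted_diamond hf hh0 hh hhsimple)
    (simpleRooted_diamond hg hh0 hh hhsimple).1.1 ?_ fun x hx ↦ ?_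
  · rw [natDegree_diamond hg.1.1 hh0, natDegree_diamond hf.1.1 hh0]
    omega
  · have := wronskian_diamond_pos hdeg' (roots_im_neg_of_derivative_mul_pos hf hdeg' hpos)
      hh0 hh hhsimple x
    rw [diamond_C_mul, derivative_C_mul, eval_C_mul, eval_C_mul] at this
    refine this.ne' ?_
    linear_combination s * hx
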